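/- Let q be a prime power, let m ≥ 2 be an integer, and set n' = ⌈q^{m−1}/(q−1)⌉. Then there exists a linear code C' with parameters [(q^m − 1)/(q−1) + n', m, q^{m−1}]_q that is a minimal code violating the Ashikhmin-Barg condition and whose weight distribution is: A_0(C') = 1, A_{q^{m−1}}(C') = q^{m−1} − 1, A_{q^{m−1}+n'}(C') = (q−1)·q^{m−1}, and A_w(C') = 0 for every other integer w. -/

import Mathlib

open Finset BigOperators

/-- Ceiling division on naturals: `cdiv a b = ⌈a / b⌉`. -/
def cdiv (a b : ℕ) : ℕ := (a + b - 1) / b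

/-- The minimum Hamming weight of a nonzero codeword of a linear code. -/
noncomputable def wmin {F : Type} [Field F] [Fintype F] [DecidableEq F] {n : ℕ}
    (C : Submodule F (Fin n → F)) : ℕ :=
  sInf {w | ∃ c ∈ C, c ≠ (0 : Fin n → F) ∧ hammingNorm c = w}

/-- The maximum Hamming weight of a codeword of a linear code. -/
noncomputable def wmax {F : Type} [Field F] [Fintype F] [DecidableEq F] {n : ℕ}
    (C : Submodule F (Fin n → F)) : ℕ :=
  sSup {w | ∃ c ∈ C, hammingNorm c = w}

/-- A linear code is minimal if every nonzero codeword `c` is minimal: any codeword `c'`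
whose support is contained in the support of `c` is a scalar multiple of `c`. -/
def IsMinimalCode {F : Type} [Field F] [Fintype F] [DecidableEq F] {n : ℕ}
    (C : Submodule F (Fin n → F)) : Prop :=
  ∀ c ∈ C, c ≠ (0 : Fin n → F) → ∀ c' ∈ C,
    {i : Fin n | c' i ≠ 0} ⊆ {i : Fin n | c i ≠ 0} → ∃ l : F, c' = l • c

/-- A linear code is self-orthogonal if the standard inner product of any two codewords is 0. -/
def SelfOrthogonal {F : Type} [Field F] {n : ℕ} (C : Submodule F (Fin n → F)) : Prop :=
  ∀ c ∈ C, ∀ c' ∈ C, ∑ i, c i * c' i = 0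

/-- A linear `[n,k]_q` code is projective if it is the image of `x ↦ (x·g_1, …, x·g_n)` for
nonzero, pairwise linearly independent vectors `g_1, …, g_n ∈ F_q^k`. -/
def IsProjectiveCode {F : Type} [Field F] {n : ℕ} (k : ℕ) (C : Submodule F (Fin n → F)) : Prop :=
  ∃ g : Fin n → (Fin k → F),
    (∀ i, g i ≠ 0) ∧
    (∀ i j, i ≠ j → ∀ l : F, g i ≠ l • g j) ∧
    (C : Set (Fin n → F)) = {c | ∃ x : Fin k → F, c = fun i => ∑ t, x t * g i t}

/-- `Aw C w` is the number of codewords of `C` of Hamming weight `w`. -/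
noncomputable def Aw {F : Type} [Field F] [Fintype F] [DecidableEq F] {n : ℕ}
    (C : Submodule F (Fin n → F)) (w : ℕ) : ℕ :=
  Set.ncard {c : Fin n → F | c ∈ C ∧ hammingNorm c = w}

section LinearForms

variable {F V : Type} [Field F] [Fintype F] [AddCommGroup V] [Module F V] [Module.Finite F V]

lemma natCard_eq_card_pow_finrank : Nat.card V = Fintype.card F ^ Module.finrank F V := by
  rw [Module.natCard_eq_pow_finrank (K := F), Nat.card_eq_fintype_card]

lemma natCard_zeros_of_ne_zero {f : V →ₗ[F] F} (hf : f ≠ 0) :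
    Nat.card {v // f v = 0} = Fintype.card F ^ (Module.finrank F V - 1) := by
  have h : Module.finrank F f.ker + 1 = Module.finrank F V :=
    Module.Dual.finrank_ker_add_one_of_ne_zero hf
  rw [← h, Nat.add_sub_cancel, ← natCard_eq_card_pow_finrank]
  rfl

lemma natCard_nonzeros_of_ne_zero {f : V →ₗ[F] F} (hf : f ≠ 0) :
    Nat.card {v // f v ≠ 0} =
      (Fintype.card F - 1) * Fintype.card F ^ (Module.finrank F V - 1) := by
  classical
  have := Module.finite_of_finite F (M := V)
  have h : Module.finrank F f.ker + 1 = Module.finrank F V :=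
    Module.Dual.finrank_ker_add_one_of_ne_zero hf
  have hsum : Nat.card {v // f v = 0} + Nat.card {v // f v ≠ 0} = Nat.card V := by
    rw [← Nat.card_sum]
    exact Nat.card_congr (Equiv.sumCompl _)
  rw [natCard_zeros_of_ne_zero hf, natCard_eq_card_pow_finrank (F := F) (V := V), ← h, pow_succ] at hsum
  rw [Nat.sub_one_mul, ← h]
  simp only [Nat.add_sub_cancel] at hsum ⊢
  rw [mul_comm]
  omega

open scoped LinearAlgebra.Projectivization

lemma natCard_projective_nonzeros_of_ne_zero {f : V →ₗ[F] F} (hf : f ≠ 0) :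
    Nat.card {P : ℙ F V // f P.rep ≠ 0} = Fintype.card F ^ (Module.finrank F V - 1) := by
  have hq : 0 < Fintype.card F - 1 := by
    have := Fintype.one_lt_card (α := F)
    omega
  let φ : {P : ℙ F V // f P.rep ≠ 0} × Fˣ → {v // f v ≠ 0} :=
    fun x ↦ ⟨x.2 • x.1.1.rep, by simpa [Units.smul_def] using x.1.2⟩
  have hφ : Function.Bijective φ := by
    constructor
    · rintro ⟨⟨P, hP⟩, a⟩ ⟨⟨Q, hQ⟩, b⟩ h
      have h' : a • P.rep = b • Q.rep := congrArg Subtype.val h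
      have hPQ : P = Q := by
        rw [← P.mk_rep, ← Q.mk_rep, Projectivization.mk_eq_mk_iff]
        exact ⟨a⁻¹ * b, by rw [mul_smul, ← h', inv_smul_smul]⟩
      subst hPQ
      have hab : (a : F) = b := smul_left_injective F P.rep_nonzero h'
      simp [Units.ext hab]
    · rintro ⟨v, hv⟩
      have hv0 : v ≠ 0 := by
        rintro rfl
        simp at hv
      obtain ⟨a, ha⟩ := Projectivization.exists_smul_eq_mk_rep F v hv0
      refine ⟨⟨⟨.mk F v hv0, ?_⟩, a⁻¹⟩, ?_⟩
      · rw [← ha]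
        simpa [Units.smul_def] using hv
      · simp [φ, ← ha]
  have hcard := Nat.card_congr (Equiv.ofBijective φ hφ)
  rw [Nat.card_prod, natCard_nonzeros_of_ne_zero hf, Nat.card_units,
    Nat.card_eq_fintype_card (α := F), mul_comm] at hcard
  exact Nat.eq_of_mul_eq_mul_left hq hcard

end LinearForms

section EvaluationCode

open scoped LinearAlgebra.Projectivization

variable {F V : Type} [Field F] [AddCommGroup V] [Module F V] {n r : ℕ}

/-- Evaluation of linear forms at representatives of all projective points, followed by `r`
further evaluations at a fixed vector. -/
noncomputable def simplexRepeat (e : Fin n ≃ ℙ F V ⊕ Fin r) (v₀ : V) :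
    Module.Dual F V →ₗ[F] Fin n → F :=
  LinearMap.pi fun i ↦
    Module.Dual.eval F V (Sum.elim Projectivization.rep (fun _ ↦ v₀) (e i))

lemma simplexRepeat_apply (e : Fin n ≃ ℙ F V ⊕ Fin r) (v₀ : V) (f : Module.Dual F V)
    (i : Fin n) :
    simplexRepeat e v₀ f i = f (Sum.elim Projectivization.rep (fun _ ↦ v₀) (e i)) := rfl

lemma mem_span_of_support_simplexRepeat_subset {e : Fin n ≃ ℙ F V ⊕ Fin r} {v₀ : V}
    {f g : Module.Dual F V}
    (h : {i | simplexRepeat e v₀ g i ≠ 0} ⊆ {i | simplexRepeat e v₀ f i ≠ 0}) :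
    ∃ l : F, g = l • f := by
  have hker : ⨅ _ : Unit, f.ker ≤ g.ker := by
    intro v hv
    simp only [iInf_const, LinearMap.mem_ker] at hv ⊢
    by_cases hv0 : v = 0
    · simp [hv0]
    obtain ⟨a, ha⟩ := Projectivization.exists_smul_eq_mk_rep F v hv0
    by_contra hg
    refine @h (e.symm (.inl (.mk F v hv0))) ?_ ?_
    · simpa [simplexRepeat_apply, ← ha, Units.smul_def] using hg
    · simp [simplexRepeat_apply, ← ha, Units.smul_def, hv]
  have := mem_span_of_iInf_ker_le_ker (L := fun _ : Unit ↦ f) hker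
  rw [Set.range_const, Submodule.mem_span_singleton] at this
  obtain ⟨l, hl⟩ := this
  exact ⟨l, hl.symm⟩

variable [Fintype F] [DecidableEq F] [Module.Finite F V]

open Classical in
lemma hammingNorm_simplexRepeat (e : Fin n ≃ ℙ F V ⊕ Fin r) (v₀ : V)
    {f : Module.Dual F V} (hf : f ≠ 0) :
    hammingNorm (simplexRepeat e v₀ f) =
      Fintype.card F ^ (Module.finrank F V - 1) + if f v₀ = 0 then 0 else r := by
  have := Module.finite_of_finite F (M := V)
  have hsum : Nat.card {i // simplexRepeat e v₀ f i ≠ 0} =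
      Nat.card {P : ℙ F V // f P.rep ≠ 0} + Nat.card {_i : Fin r // f v₀ ≠ 0} := by
    rw [← Nat.card_sum]
    refine Nat.card_congr (Equiv.trans (e.subtypeEquiv (q := fun x ↦
      f (Sum.elim Projectivization.rep (fun _ ↦ v₀) x) ≠ 0) fun i ↦ Iff.rfl) ?_)
    exact Equiv.subtypeSum
  rw [hammingNorm, ← Fintype.card_subtype, ← Nat.card_eq_fintype_card, hsum,
    natCard_projective_nonzeros_of_ne_zero hf]
  by_cases h : f v₀ = 0 <;> simp [h]

lemma simplexRepeat_injective (e : Fin n ≃ ℙ F V ⊕ Fin r) (v₀ : V) :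
    Function.Injective (simplexRepeat e v₀) := by
  rw [injective_iff_map_eq_zero]
  intro f hf
  by_contra h
  have hw := hammingNorm_simplexRepeat e v₀ h
  have : 0 < Fintype.card F ^ (Module.finrank F V - 1) := Nat.pow_pos Fintype.card_pos
  rw [hf, hammingNorm_zero] at hw
  omega

end EvaluationCode

lemma Aw_range {F W : Type} [Field F] [Fintype F] [DecidableEq F] [AddCommGroup W] [Module F W]
    {n : ℕ} {φ : W →ₗ[F] Fin n → F} (hφ : Function.Injective φ) (w : ℕ) :
    Aw φ.range w = Nat.card {x // hammingNorm (φ x) = w} := by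
  have : {c | c ∈ φ.range ∧ hammingNorm c = w} = φ '' {x | hammingNorm (φ x) = w} := by
    ext c
    constructor
    · rintro ⟨⟨x, rfl⟩, hx⟩
      exact ⟨x, hx, rfl⟩
    · rintro ⟨x, hx, rfl⟩
      exact ⟨⟨x, rfl⟩, hx⟩
  rw [Aw, this, Set.ncard_image_of_injective _ hφ]
  rfl

lemma le_wmax {F : Type} [Field F] [Fintype F] [DecidableEq F] {n : ℕ}
    {C : Submodule F (Fin n → F)} {c : Fin n → F} (hc : c ∈ C) : hammingNorm c ≤ wmax C := by
  refine le_csSup ⟨n, ?_⟩ ⟨c, hc, rfl⟩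
  rintro _ ⟨d, -, rfl⟩
  simpa using hammingNorm_le_card_fintype (x := d)

lemma wmin_eq_of_forall_le {F : Type} [Field F] [Fintype F] [DecidableEq F] {n : ℕ}
    {C : Submodule F (Fin n → F)} {c : Fin n → F} (hc : c ∈ C) (hc0 : c ≠ 0)
    (h : ∀ d ∈ C, d ≠ 0 → hammingNorm c ≤ hammingNorm d) : wmin C = hammingNorm c := by
  refine le_antisymm (Nat.sInf_le ⟨c, hc, hc0, rfl⟩) (le_csInf ⟨_, c, hc, hc0, rfl⟩ ?_)
  rintro _ ⟨d, hd, hd0, rfl⟩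
  exact h d hd hd0

lemma le_mul_cdiv (a : ℕ) {b : ℕ} (hb : 0 < b) : a ≤ b * cdiv a b := by
  have h := Nat.lt_mul_div_succ (a + b - 1) hb
  rw [mul_add, mul_one] at h
  unfold cdiv
  omega

/-- Proposition 6.1. Two-weight minimal codes violating the Ashikhmin-Barg
condition obtained from simplex codes, with explicit weight distribution. -/
theorem minimal_code_from_simplex_weight_distribution
    {F : Type} [Field F] [Fintype F] [DecidableEq F] {m : ℕ} (hm : 2 ≤ m)
    (n' : ℕ) (hn' : n' = cdiv (Fintype.card F ^ (m - 1)) (Fintype.card F - 1)) :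
    ∃ C' : Submodule F
        (Fin ((Fintype.card F ^ m - 1) / (Fintype.card F - 1) + n') → F),
      Module.finrank F C' = m ∧
      wmin C' = Fintype.card F ^ (m - 1) ∧
      IsMinimalCode C' ∧
      Fintype.card F * wmin C' ≤ (Fintype.card F - 1) * wmax C' ∧
      Aw C' 0 = 1 ∧
      Aw C' (Fintype.card F ^ (m - 1)) = Fintype.card F ^ (m - 1) - 1 ∧
      Aw C' (Fintype.card F ^ (m - 1) + n') = (Fintype.card F - 1) * Fintype.card F ^ (m - 1) ∧
      (∀ w : ℕ, w ≠ 0 → w ≠ Fintype.card F ^ (m - 1) →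
        w ≠ Fintype.card F ^ (m - 1) + n' → Aw C' w = 0) := by
  classical
  have hq1 : 1 < Fintype.card F := Fintype.one_lt_card
  have hQ : 0 < Fintype.card F ^ (m - 1) := by positivity
  have hn := le_mul_cdiv (Fintype.card F ^ (m - 1)) (b := Fintype.card F - 1) (by omega)
  rw [← hn'] at hn
  have hn0 : 0 < n' := Nat.pos_of_mul_pos_left (hQ.trans_le hn)
  have hV : Module.finrank F (Fin m → F) = m := by simp
  have hD : Module.finrank F (Module.Dual F (Fin m → F)) = m := by simp
  have := Module.finite_of_finite F (M := Module.Dual F (Fin m → F))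
  have hP : Nat.card (Projectivization F (Fin m → F)) =
      (Fintype.card F ^ m - 1) / (Fintype.card F - 1) := by
    rw [Projectivization.card'', natCard_eq_card_pow_finrank (F := F), hV,
      Nat.card_eq_fintype_card]
  have e : Fin ((Fintype.card F ^ m - 1) / (Fintype.card F - 1) + n') ≃
      Projectivization F (Fin m → F) ⊕ Fin n' :=
    finSumFinEquiv.symm.trans
      (Equiv.sumCongr ((Finite.equivFinOfCardEq hP).symm) (Equiv.refl _))
  let i₀ : Fin m := ⟨0, by omega⟩
  let i₁ : Fin m := ⟨1, by omega⟩
  have hi : i₀ ≠ i₁ := by simp [i₀, i₁]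
  let v₀ : Fin m → F := Pi.single i₀ 1
  let f₀ : Module.Dual F (Fin m → F) := LinearMap.proj i₀
  let f₁ : Module.Dual F (Fin m → F) := LinearMap.proj i₁
  have hf₀v : f₀ v₀ ≠ 0 := by simp [f₀, v₀]
  have hf₀ : f₀ ≠ 0 := fun h ↦ hf₀v (by simp [h])
  have hf₁v : f₁ v₀ = 0 := by simp [f₁, v₀, hi.symm]
  have hf₁ : f₁ ≠ 0 := fun h ↦ by
    simpa [f₁] using LinearMap.congr_fun h (Pi.single i₁ 1)
  let φ := simplexRepeat e v₀
  have hφ : Function.Injective φ := simplexRepeat_injective e v₀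
  have hw {f : Module.Dual F (Fin m → F)} (hf : f ≠ 0) :
      hammingNorm (φ f) = Fintype.card F ^ (m - 1) + if f v₀ = 0 then 0 else n' := by
    have := hammingNorm_simplexRepeat e v₀ hf
    rwa [hV] at this
  have hev : Module.Dual.eval F (Fin m → F) v₀ ≠ 0 := fun h ↦
    hf₀v (by simpa using LinearMap.congr_fun h f₀)
  have hw₀ : hammingNorm (φ f₀) = Fintype.card F ^ (m - 1) + n' := by simp [hw hf₀, hf₀v]
  have hw₁ : hammingNorm (φ f₁) = Fintype.card F ^ (m - 1) := by simp [hw hf₁, hf₁v]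
  have hmin : wmin φ.range = Fintype.card F ^ (m - 1) := by
    rw [← hw₁]
    refine wmin_eq_of_forall_le ⟨f₁, rfl⟩ ((map_ne_zero_iff φ hφ).2 hf₁) ?_
    rintro _ ⟨f, rfl⟩ hf
    rw [hw₁, hw ((map_ne_zero_iff φ hφ).1 hf)]
    exact Nat.le_add_right _ _
  refine ⟨φ.range, ?_, hmin, ?_, ?_, ?_, ?_, ?_, ?_⟩
  · rw [LinearMap.finrank_range_of_inj hφ, hD]
  · rintro _ ⟨f, rfl⟩ - _ ⟨g, rfl⟩ hsub
    obtain ⟨l, rfl⟩ := mem_span_of_support_simplexRepeat_subset hsub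
    exact ⟨l, map_smul φ l f⟩
  · rw [hmin]
    calc Fintype.card F * Fintype.card F ^ (m - 1)
        = (Fintype.card F - 1) * Fintype.card F ^ (m - 1) + Fintype.card F ^ (m - 1) := by
          rw [← Nat.succ_mul]
          congr 1
          omega
      _ ≤ (Fintype.card F - 1) * (Fintype.card F ^ (m - 1) + n') := by
          rw [mul_add]
          exact Nat.add_le_add_left hn _
      _ ≤ (Fintype.card F - 1) * wmax φ.range := by
          rw [← hw₀]
          exact Nat.mul_le_mul_left _ (le_wmax ⟨f₀, rfl⟩)
  · rw [Aw_range hφ]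
    simp [map_eq_zero_iff φ hφ]
  · rw [Aw_range hφ]
    have hset : {f | hammingNorm (φ f) = Fintype.card F ^ (m - 1)} =
        {f : Module.Dual F (Fin m → F) | f v₀ = 0} \ {0} := by
      ext f
      by_cases hf : f = 0
      · simp [hf]
        omega
      · by_cases h : f v₀ = 0 <;> simp [hw hf, hf, h]
        omega
    have hcard := natCard_zeros_of_ne_zero hev
    rw [hD] at hcard
    change Set.ncard {f | hammingNorm (φ f) = Fintype.card F ^ (m - 1)} = _
    rw [hset, Set.ncard_sdiff_singleton_of_mem (by simp)]
    exact congrArg (· - 1) hcard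
  · rw [Aw_range hφ]
    have hcard := natCard_nonzeros_of_ne_zero hev
    rw [hD] at hcard
    rw [← hcard]
    refine Nat.card_congr (Equiv.subtypeEquivRight fun f ↦ ?_)
    by_cases hf : f = 0
    · simp [hf]
      omega
    · by_cases h : f v₀ = 0 <;> simp [hw hf, h]
      omega
  · intro w h0 h1 h2
    rw [Aw_range hφ]
    have : IsEmpty {f // hammingNorm (φ f) = w} := by
      refine ⟨fun ⟨f, hf⟩ ↦ ?_⟩
      by_cases hf0 : f = 0
      · simp [hf0] at hf
        omega
      · rw [hw hf0] at hf
        split_ifs at hf <;> omega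
    exact Nat.card_of_isEmpty
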